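/- arXiv:2102.02323 — 2 statements merged into one kernel-verified Lean document; each statement's English description precedes it below -/
import Mathlib

section
/- Let k ≥ d ≥ 2 and let x, y ∈ (ℝ^d)^k be nondegenerate configurations. Then x and y have the same volume type (T_{k,d}(x) = T_{k,d}(y)) if and only if there exists a unique matrix g ∈ SL_d(ℝ) such that g x^j = y^j for every j = 1,…,k. -/
noncomputable section

/-- The determinant of the `d × d` matrix with columns `x 0, …, x (d-1)`. -/
def detCols {d : ℕ} (x : Fin d → (Fin d → ℝ)) : ℝ :=
  Matrix.det (Matrix.of fun l i => x i l)

/-- The volume type of a configuration `x ∈ (ℝ^d)^k`: the vector, indexed by the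
`d`-element subsets of `{1,…,k}`, of determinants of the corresponding columns
(listed in increasing order). -/
def volType (d k : ℕ) (x : Fin k → (Fin d → ℝ)) :
    {S : Finset (Fin k) // S.card = d} → ℝ :=
  fun S => detCols fun j => x (S.1.orderIsoOfFin S.2 j)

/-- A configuration `x ∈ (ℝ^d)^k` is nondegenerate if its first `d` points are
linearly independent. -/
def Nondegenerate (d k : ℕ) (hk : d ≤ k) (x : Fin k → (Fin d → ℝ)) : Prop :=
  LinearIndependent ℝ fun i : Fin d => x (Fin.castLE hk i)

/-- Permuting the columns multiplies the determinant by the sign of the permutation. -/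
theorem detCols_comp_perm {d : ℕ} (x : Fin d → (Fin d → ℝ)) (σ : Equiv.Perm (Fin d)) :
    detCols (fun i => x (σ i)) = (Equiv.Perm.sign σ : ℤ) * detCols x :=
  Matrix.det_permute' σ (Matrix.of fun l i => x i l)

/-- Applying a matrix to every column multiplies the determinant by that of the matrix. -/
theorem detCols_mulVec {d : ℕ} (g : Matrix (Fin d) (Fin d) ℝ) (x : Fin d → (Fin d → ℝ)) :
    detCols (fun i => g.mulVec (x i)) = g.det * detCols x :=
  Matrix.det_mul g (Matrix.of fun l i => x i l)

theorem detCols_ne_zero {d : ℕ} {x : Fin d → (Fin d → ℝ)} (hx : LinearIndependent ℝ x) :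
    detCols x ≠ 0 := by
  have h : IsUnit (Matrix.of fun l i => x i l) := Matrix.linearIndependent_cols_iff_isUnit.mp hx
  exact ((Matrix.isUnit_iff_isUnit_det _).mp h).ne_zero

/-- The volume type determines the determinants of all `d`-tuples of points, in any order and
with repetitions. -/
theorem detCols_comp_eq_of_volType_eq {d k : ℕ} {x y : Fin k → (Fin d → ℝ)}
    (h : volType d k x = volType d k y) (f : Fin d → Fin k) :
    detCols (fun i => x (f i)) = detCols (fun i => y (f i)) := by
  by_cases hf : Function.Injective f
  · have hmono : StrictMono (f ∘ Tuple.sort f) :=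
      (Tuple.monotone_sort f).strictMono_of_injective (hf.comp (Tuple.sort f).injective)
    have hcard : (Finset.univ.image f).card = d := by
      simp [Finset.card_image_of_injective _ hf]
    have hsort : f ∘ Tuple.sort f = (Finset.univ.image f).orderEmbOfFin hcard :=
      Finset.orderEmbOfFin_unique hcard (fun i => by simp) hmono
    have key : detCols (fun i => x (f (Tuple.sort f i))) =
        detCols (fun i => y (f (Tuple.sort f i))) := by
      have hi (i : Fin d) : f (Tuple.sort f i) =
          (Finset.univ.image f).orderIsoOfFin hcard i := congrFun hsort i
      simp only [hi]
      exact congrFun h ⟨_, hcard⟩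
    rw [detCols_comp_perm (fun i => x (f i)), detCols_comp_perm (fun i => y (f i))] at key
    exact mul_left_cancel₀ (Int.cast_ne_zero.mpr (Units.ne_zero _)) key
  · obtain ⟨i, j, hij, hne⟩ := Function.not_injective_iff.mp hf
    have hzero (z : Fin k → (Fin d → ℝ)) : detCols (fun i => z (f i)) = 0 :=
      Matrix.det_zero_of_column_eq hne fun l => by simp [hij]
    rw [hzero, hzero]

/-- Lemma (group action): two nondegenerate configurations have the same volume
type iff there is a unique `g ∈ SL_d(ℝ)` with `g x^j = y^j` for all `j`. -/
theorem same_volType_iff_exists_unique_sl (d k : ℕ) (hd : 2 ≤ d) (hk : d ≤ k)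
    (x y : Fin k → (Fin d → ℝ))
    (hx : Nondegenerate d k hk x) (hy : Nondegenerate d k hk y) :
    volType d k x = volType d k y ↔
      ∃! g : Matrix.SpecialLinearGroup (Fin d) ℝ,
        ∀ j : Fin k, (g : Matrix (Fin d) (Fin d) ℝ).mulVec (x j) = y j := by
  set X : Matrix (Fin d) (Fin d) ℝ := Matrix.of fun l i => x (Fin.castLE hk i) l with hX
  set Y : Matrix (Fin d) (Fin d) ℝ := Matrix.of fun l i => y (Fin.castLE hk i) l with hY
  have hXdet : X.det ≠ 0 := detCols_ne_zero hx
  have hXunit : IsUnit X.det := hXdet.isUnit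
  constructor
  · intro h
    have hdet : X.det = Y.det := detCols_comp_eq_of_volType_eq h (Fin.castLE hk)
    have hcramer (j : Fin k) : X.cramer (x j) = Y.cramer (y j) := by
      ext i
      have hupdate (z : Fin k → (Fin d → ℝ)) :
          ((Matrix.of fun l i => z (Fin.castLE hk i) l).updateCol i (z j)).det =
            detCols (fun m => z (Function.update (Fin.castLE hk) i j m)) := by
        unfold detCols
        congr 1
        ext l m
        by_cases hm : m = i
        · subst hm
          simp
        · simp [hm]
      rw [Matrix.cramer_apply, Matrix.cramer_apply, hX, hY, hupdate, hupdate]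
      exact detCols_comp_eq_of_volType_eq h _
    have hgdet : (Y * X⁻¹).det = 1 := by
      rw [Matrix.det_mul, ← hdet, ← Matrix.det_mul, Matrix.mul_nonsing_inv X hXunit,
        Matrix.det_one]
    refine ⟨⟨Y * X⁻¹, hgdet⟩, fun j => ?_, fun g hg => Subtype.ext ?_⟩
    · have hsmul : X.det • (Y * X⁻¹).mulVec (x j) = X.det • y j := by
        rw [← Matrix.mulVec_smul, ← Matrix.mulVec_cramer, Matrix.mulVec_mulVec,
          Matrix.mul_assoc, Matrix.nonsing_inv_mul X hXunit, Matrix.mul_one, hcramer,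
          Matrix.mulVec_cramer, hdet]
      exact smul_right_injective _ hXdet hsmul
    · have hmul : (g : Matrix (Fin d) (Fin d) ℝ) * X = Y := by
        ext l i
        exact congrFun (hg (Fin.castLE hk i)) l
      change (g : Matrix (Fin d) (Fin d) ℝ) = Y * X⁻¹
      rw [← hmul, Matrix.mul_nonsing_inv_cancel_right _ _ hXunit]
  · rintro ⟨g, hg, -⟩
    ext S
    simp only [volType, ← hg, detCols_mulVec, g.det_coe, one_mul]
end
end

section
/- Let k ≥ d ≥ 2 and define Φ : (ℝ \ {0}) × (ℝ^d)^{k−d} → ℝ^{C(k,d)} by letting Φ(t, z^{d+1},…,z^k) be the volume type of the configuration (e^1,…,e^{d−1}, t e^d, z^{d+1},…,z^k). Then Φ is infinitely differentiable, injective, its Fréchet derivative is injective at every point of its (open) domain, Φ is a homeomorphism onto its image, and its image equals the set of volume types of all nondegenerate configurations in (ℝ^d)^k. In particular, the set of volume types of nondegenerate k-point configurations in ℝ^d is the image of a smooth embedding of an open subset of ℝ^{d(k−d)+1}. -/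
noncomputable section

/-- The configuration `(e^1, …, e^{d-1}, t e^d, z^{d+1}, …, z^k)`, where
`e^1, …, e^d` are the standard basis vectors of `ℝ^d`. -/
def baseConfig (d k : ℕ) (t : ℝ) (z : Fin (k - d) → (Fin d → ℝ)) :
    Fin k → (Fin d → ℝ) :=
  fun i =>
    if h1 : i.1 + 1 < d then fun l => if l.1 = i.1 then 1 else 0
    else if h2 : i.1 + 1 = d then fun l => if l.1 = i.1 then t else 0
    else z ⟨i.1 - d, by have := i.2; omega⟩

/-- The map `Φ(t, z^{d+1}, …, z^k)` = volume type of
`(e^1, …, e^{d-1}, t e^d, z^{d+1}, …, z^k)`, defined on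
`ℝ × (ℝ^d)^{k-d} ≅ ℝ^{d(k-d)+1}`. -/
def Phi (d k : ℕ) (p : ℝ × (Fin (k - d) → (Fin d → ℝ))) :
    {S : Finset (Fin k) // S.card = d} → ℝ :=
  volType d k (baseConfig d k p.1 p.2)

open Finset in
/-- A determinant of points of `x` indexed by an injection `f` is, up to a sign depending only
on `f`, a coordinate of the volume type. -/
lemma exists_detCols_comp_eq {d k : ℕ} (f : Fin d → Fin k) (hf : Function.Injective f) :
    ∃ (S : {S : Finset (Fin k) // S.card = d}) (ε : ℝ), ∀ x : Fin k → (Fin d → ℝ),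
      detCols (fun j => x (f j)) = ε * volType d k x S := by
  have hS : (univ.image f).card = d := by
    rw [card_image_of_injective _ hf, card_univ, Fintype.card_fin]
  let g : Fin d → Fin d := fun j =>
    ((univ.image f).orderIsoOfFin hS).symm ⟨f j, mem_image_of_mem f (mem_univ j)⟩
  have hg : Function.Injective g := fun i j h => by
    have := ((univ.image f).orderIsoOfFin hS).symm.injective h
    exact hf (Subtype.ext_iff.1 this)
  let σ : Equiv.Perm (Fin d) := Equiv.ofBijective g (Finite.injective_iff_bijective.1 hg)
  refine ⟨⟨univ.image f, hS⟩, (Equiv.Perm.sign σ : ℤ), fun x => ?_⟩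
  have hσ : ∀ j, ((univ.image f).orderIsoOfFin hS (σ j) : Fin k) = f j := fun j => by
    change ((univ.image f).orderIsoOfFin hS (g j) : Fin k) = f j
    simp only [g, OrderIso.apply_symm_apply]
  unfold volType detCols
  rw [← Matrix.det_permute']
  congr 1
  ext l j
  simp only [Matrix.of_apply, Matrix.submatrix_apply, id_eq, hσ]

/-- The volume type is equivariant under linear maps. -/
lemma volType_mulVec {d k : ℕ} (M : Matrix (Fin d) (Fin d) ℝ) (x : Fin k → (Fin d → ℝ)) :
    volType d k (fun i => M.mulVec (x i)) = M.det • volType d k x := by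
  ext S
  simp only [volType, detCols, Pi.smul_apply, smul_eq_mul]
  rw [← Matrix.det_mul]
  rfl

/-- The scale of the `i`-th basis vector in `baseConfig`. -/
def baseScale (d : ℕ) (t : ℝ) (i : Fin d) : ℝ := if i.1 + 1 < d then 1 else t

lemma prod_baseScale {d : ℕ} (hd : 0 < d) (t : ℝ) : ∏ i, baseScale d t i = t := by
  rw [Finset.prod_eq_single (⟨d - 1, by omega⟩ : Fin d)]
  · rw [baseScale, if_neg (by simp; omega)]
  · intro i _ hi
    have : i.1 ≠ d - 1 := fun h => hi (Fin.ext h)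
    rw [baseScale, if_pos (by omega)]
  · simp

lemma contDiff_baseScale (d : ℕ) (i : Fin d) {n : WithTop ℕ∞} :
    ContDiff ℝ n (fun t => baseScale d t i) := by
  unfold baseScale
  split_ifs <;> fun_prop

lemma baseConfig_castLE {d k : ℕ} (hk : d ≤ k) (t : ℝ) (z : Fin (k - d) → (Fin d → ℝ))
    (i l : Fin d) :
    baseConfig d k t z (Fin.castLE hk i) l = Matrix.diagonal (baseScale d t) l i := by
  have hi := i.2
  simp only [baseConfig, Fin.val_castLE, Matrix.diagonal_apply, baseScale, Fin.ext_iff]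
  by_cases h1 : i.1 + 1 < d
  · simp only [h1, dite_true]
    split_ifs <;> first | rfl | omega
  · have h2 : i.1 + 1 = d := by omega
    rw [dif_neg h1, dif_pos h2]
    split_ifs <;> first | rfl | omega

/-- The index in `Fin k` of the `m`-th point of the tail of a configuration. -/
def tailIndex (d k : ℕ) (m : Fin (k - d)) : Fin k := ⟨d + m.1, by have := m.2; omega⟩

lemma baseConfig_tailIndex {d k : ℕ} (t : ℝ) (z : Fin (k - d) → (Fin d → ℝ))
    (m : Fin (k - d)) : baseConfig d k t z (tailIndex d k m) = z m := by
  rw [baseConfig, dif_neg (by simp [tailIndex]; omega), dif_neg (by simp [tailIndex]; omega)]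
  congr 1
  ext
  simp [tailIndex]

/-- Any configuration index is in the head or in the tail. -/
lemma eq_castLE_or_eq_tailIndex {d k : ℕ} (hk : d ≤ k) (i : Fin k) :
    (∃ j : Fin d, i = Fin.castLE hk j) ∨ ∃ m, i = tailIndex d k m := by
  by_cases h : i.1 < d
  · exact .inl ⟨⟨i, h⟩, rfl⟩
  · exact .inr ⟨⟨i - d, by omega⟩, Fin.ext (by simp [tailIndex]; omega)⟩

lemma contDiff_baseConfig {d k : ℕ} (hk : d ≤ k) (i : Fin k) (l : Fin d) {n : WithTop ℕ∞} :
    ContDiff ℝ n (fun p : ℝ × (Fin (k - d) → (Fin d → ℝ)) => baseConfig d k p.1 p.2 i l) := by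
  rcases eq_castLE_or_eq_tailIndex hk i with ⟨j, rfl⟩ | ⟨m, rfl⟩
  · simp only [baseConfig_castLE, Matrix.diagonal_apply]
    split_ifs
    · exact (contDiff_baseScale d l).comp contDiff_fst
    · exact contDiff_const
  · simp only [baseConfig_tailIndex]
    fun_prop

lemma contDiff_Phi {d k : ℕ} (hk : d ≤ k) {n : WithTop ℕ∞} : ContDiff ℝ n (Phi d k) := by
  refine contDiff_pi.2 fun S => ?_
  simp only [Phi, volType, detCols, Matrix.det_apply, Matrix.of_apply]
  exact ContDiff.sum fun σ _ => (contDiff_prod fun i _ => contDiff_baseConfig hk _ _).const_smul _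

lemma detCols_baseConfig_castLE {d k : ℕ} (hd : 0 < d) (hk : d ≤ k) (t : ℝ)
    (z : Fin (k - d) → (Fin d → ℝ)) :
    detCols (fun j => baseConfig d k t z (Fin.castLE hk j)) = t := by
  simp only [detCols, baseConfig_castLE]
  exact (Matrix.det_diagonal).trans (prod_baseScale hd t)

/-- Cramer's rule for the base configuration. -/
lemma detCols_baseConfig_update {d k : ℕ} (hd : 0 < d) (hk : d ≤ k) (t : ℝ)
    (z : Fin (k - d) → (Fin d → ℝ)) (m : Fin (k - d)) (l : Fin d) :
    detCols (fun j => baseConfig d k t z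
      (Function.update (Fin.castLE hk) l (tailIndex d k m) j)) * baseScale d t l = t * z m l := by
  have h : (Matrix.of fun r j => baseConfig d k t z
      (Function.update (Fin.castLE hk) l (tailIndex d k m) j) r) =
      (Matrix.diagonal (baseScale d t)).updateCol l (z m) := by
    ext r j
    rcases eq_or_ne j l with rfl | hj
    · simp [baseConfig_tailIndex]
    · simp [hj, baseConfig_castLE]
  rw [detCols, h, ← Matrix.cramer_apply, Matrix.cramer_eq_adjugate_mulVec,
    Matrix.adjugate_diagonal, Matrix.mulVec_diagonal]
  rw [mul_right_comm, Finset.prod_erase_mul _ _ (Finset.mem_univ l), prod_baseScale hd]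

lemma update_castLE_tailIndex_injective {d k : ℕ} (hk : d ≤ k) (l : Fin d) (m : Fin (k - d)) :
    Function.Injective (Function.update (Fin.castLE hk) l (tailIndex d k m)) := by
  intro i j h
  have hi := i.2
  have hj := j.2
  simp only [Function.update_apply, tailIndex] at h
  split_ifs at h <;> simp [Fin.ext_iff] at h ⊢ <;> grind

/-- `Phi` has a left inverse that is smooth on an open set containing the image. -/
lemma exists_smooth_leftInverse_Phi {d k : ℕ} (hd : 0 < d) (hk : d ≤ k) :
    ∃ (L : ({S : Finset (Fin k) // S.card = d} → ℝ) → ℝ)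
      (G : ({S : Finset (Fin k) // S.card = d} → ℝ) → ℝ × (Fin (k - d) → (Fin d → ℝ))),
      (∀ p, L (Phi d k p) = p.1) ∧
      (∀ v, L v ≠ 0 → ContDiffAt ℝ 1 G v) ∧ ∀ p, p.1 ≠ 0 → G (Phi d k p) = p := by
  obtain ⟨S₀, ε₀, h₀⟩ := exists_detCols_comp_eq (Fin.castLE hk) (Fin.castLE_injective hk)
  choose S ε h using fun (m : Fin (k - d)) (l : Fin d) =>
    exists_detCols_comp_eq _ (update_castLE_tailIndex_injective hk l m)
  have hL : ∀ p, ε₀ * Phi d k p S₀ = p.1 := fun p => by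
    rw [Phi, ← h₀, detCols_baseConfig_castLE hd hk]
  refine ⟨fun v => ε₀ * v S₀, fun v => (ε₀ * v S₀, fun m l =>
    ε m l * v (S m l) * baseScale d (ε₀ * v S₀) l / (ε₀ * v S₀)), hL, fun v hv => ?_,
    fun p hp => ?_⟩
  · have h₁ : ContDiff ℝ 1 fun v : {S : Finset (Fin k) // S.card = d} → ℝ => ε₀ * v S₀ := by
      fun_prop
    refine h₁.contDiffAt.prodMk (contDiffAt_pi.2 fun m => contDiffAt_pi.2 fun l => ?_)
    refine ContDiffAt.div (ContDiff.contDiffAt ?_) h₁.contDiffAt hv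
    exact ContDiff.mul (by fun_prop) ((contDiff_baseScale d l).comp h₁)
  · refine Prod.ext (hL p) (funext fun m => funext fun l => ?_)
    simp only [hL]
    rw [Phi, ← h, detCols_baseConfig_update hd hk, mul_div_cancel_left₀ _ hp]

/-- A family of `d` vectors in `ℝ^d` is independent iff its determinant is nonzero. -/
lemma linearIndependent_iff_detCols_ne_zero {d : ℕ} (x : Fin d → (Fin d → ℝ)) :
    LinearIndependent ℝ x ↔ detCols x ≠ 0 := by
  rw [detCols, ← isUnit_iff_ne_zero, ← Matrix.isUnit_iff_isUnit_det,
    ← Matrix.linearIndependent_cols_iff_isUnit]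
  rfl

/-- Every nondegenerate configuration has the volume type of a base configuration. -/
lemma exists_Phi_eq_volType {d k : ℕ} (hd : 0 < d) (hk : d ≤ k) (x : Fin k → (Fin d → ℝ))
    (hx : Nondegenerate d k hk x) : ∃ p, p.1 ≠ 0 ∧ Phi d k p = volType d k x := by
  let A : Matrix (Fin d) (Fin d) ℝ := Matrix.of fun l i => x (Fin.castLE hk i) l
  have hA : A.det ≠ 0 := (linearIndependent_iff_detCols_ne_zero _).1 hx
  let M := Matrix.diagonal (baseScale d A.det) * A⁻¹
  have hM : M.det = 1 := by
    rw [Matrix.det_mul, Matrix.det_diagonal, prod_baseScale hd, Matrix.det_nonsing_inv,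
      Ring.inverse_eq_inv', mul_inv_cancel₀ hA]
  have hMA : M * A = Matrix.diagonal (baseScale d A.det) :=
    Matrix.nonsing_inv_mul_cancel_right _ _ (isUnit_iff_ne_zero.2 hA)
  refine ⟨(A.det, fun m => M.mulVec (x (tailIndex d k m))), hA, ?_⟩
  rw [← one_smul ℝ (volType d k x), ← hM, ← volType_mulVec, Phi]
  congr 1
  ext i l
  rcases eq_castLE_or_eq_tailIndex hk i with ⟨j, rfl⟩ | ⟨m, rfl⟩
  · rw [baseConfig_castLE, ← hMA]
    rfl
  · rw [baseConfig_tailIndex]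

/-- On the open set `U = (ℝ \ {0}) × (ℝ^d)^{k-d}`, the map `Φ` is smooth,
injective, an immersion (injective Fréchet derivative at each point), a
topological embedding onto its image, and its image is exactly the set of
volume types of nondegenerate `k`-point configurations in `ℝ^d`. -/
theorem volType_manifold (d k : ℕ) (hd : 2 ≤ d) (hk : d ≤ k) :
    ContDiffOn ℝ (⊤ : ℕ∞) (Phi d k) {p | p.1 ≠ 0} ∧
    Set.InjOn (Phi d k) {p | p.1 ≠ 0} ∧
    (∀ p ∈ ({p | p.1 ≠ 0} : Set (ℝ × (Fin (k - d) → (Fin d → ℝ)))),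
      Function.Injective (fderiv ℝ (Phi d k) p)) ∧
    Topology.IsEmbedding
      (fun q : {p : ℝ × (Fin (k - d) → (Fin d → ℝ)) // p.1 ≠ 0} => Phi d k q.1) ∧
    Phi d k '' {p | p.1 ≠ 0} =
      {v | ∃ x : Fin k → (Fin d → ℝ), Nondegenerate d k hk x ∧ volType d k x = v} := by
  obtain ⟨L, G, hL, hG, hGP⟩ := exists_smooth_leftInverse_Phi (by omega : 0 < d) hk
  refine ⟨(contDiff_Phi hk).contDiffOn, ?_, ?_, ?_, ?_⟩
  · intro p hp q hq h
    rw [← hGP p hp, h, hGP q hq]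
  · intro p hp
    have hG' := ((hG _ (by rwa [hL])).differentiableAt one_ne_zero).hasFDerivAt (x := Phi d k p)
    have hP := ((contDiff_Phi hk (n := 1)).differentiable one_ne_zero p).hasFDerivAt
    have hid : G ∘ Phi d k =ᶠ[nhds p] id := by
      filter_upwards [(isOpen_ne_fun continuous_fst continuous_const).mem_nhds hp] with q hq
      exact hGP q hq
    have hcomp := ((hasFDerivAt_id p).congr_of_eventuallyEq hid).unique (hG'.comp p hP)
    intro u w h
    have hu := DFunLike.congr_fun hcomp u
    have hw := DFunLike.congr_fun hcomp w
    simp only [ContinuousLinearMap.comp_apply, ContinuousLinearMap.id_apply] at hu hw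
    rw [hu, hw, h]
  · let f : {p : ℝ × (Fin (k - d) → (Fin d → ℝ)) // p.1 ≠ 0} → {v // L v ≠ 0} :=
      fun q => ⟨Phi d k q.1, by rw [hL]; exact q.2⟩
    have hf : Continuous f :=
      ((contDiff_Phi hk (n := 0)).continuous.comp continuous_subtype_val).subtype_mk _
    have hg : Continuous fun v : {v // L v ≠ 0} => G v.1 := continuous_iff_continuousAt.2 fun v =>
      (hG v.1 v.2).continuousAt.comp continuous_subtype_val.continuousAt
    refine Topology.IsEmbedding.subtypeVal.comp (Topology.IsEmbedding.of_comp hf hg ?_)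
    convert Topology.IsEmbedding.subtypeVal using 1
    exact funext fun q => hGP q.1 q.2
  · ext v
    constructor
    · rintro ⟨p, hp, rfl⟩
      refine ⟨_, (linearIndependent_iff_detCols_ne_zero _).2 ?_, rfl⟩
      rwa [detCols_baseConfig_castLE (by omega) hk]
    · rintro ⟨x, hx, rfl⟩
      exact exists_Phi_eq_volType (by omega) hk x hx
end
end
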